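/- arXiv:2411.08484 — 3 statements merged into one kernel-verified Lean document; each statement's English description precedes it below -/
import Mathlib

section
/- For every real number a > 0, the integral ∫₀¹ (ln x)/((a² + (ln x)²)²·(1 + x)) dx equals −1/(4a²) − (1/(8aπ))·ψ⁽¹⁾(a/(2π)) + (1/(2aπ))·ψ⁽¹⁾(a/π). -/
open Real MeasureTheory

/-- The trigamma function `ψ⁽¹⁾`: the second derivative of `log ∘ Γ` on the positive reals. -/
noncomputable def trigamma (x : ℝ) : ℝ :=
  deriv (deriv (fun y => Real.log (Real.Gamma y))) x

open Filter Topology Set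

/-- The partial fraction expansion of `π * coth (π * x) - 1 / x`. -/
theorem hasSum_two_mul_div_sq_add_sq {x : ℝ} (hx : 0 < x) :
    HasSum (fun n : ℕ => 2 * x / (x ^ 2 + (n + 1) ^ 2))
      (π * ((exp (2 * π * x) + 1) / (exp (2 * π * x) - 1)) - 1 / x) := by
  have hz : (x * Complex.I : ℂ) ∈ Complex.integerComplement := by
    rw [Complex.mem_integerComplement_iff]
    rintro ⟨n, hn⟩
    have := congrArg Complex.im hn
    simp at this
    exact hx.ne this
  have h := (summable_cotTerm hz).hasSum
  have hs : ∑' n, cotTerm (x * Complex.I) n = _ := (cot_series_rep' hz).symm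
  rw [hs, Complex.cot_pi_eq_exp_ratio] at h
  rw [← Complex.hasSum_ofReal]
  have hE : Complex.exp (2 * π * Complex.I * (x * Complex.I)) = ((exp (2 * π * x))⁻¹ : ℝ) := by
    rw [← Real.exp_neg, Complex.ofReal_exp]
    congr 1
    push_cast
    linear_combination (2 * π * x : ℂ) * Complex.I_sq
  have hgt : 1 < exp (2 * π * x) := Real.one_lt_exp_iff.2 (by positivity)
  have hgt' : ((exp (2 * π * x) : ℝ) : ℂ) - 1 ≠ 0 := by
    exact_mod_cast (sub_pos.2 hgt).ne'
  have h0 : ((exp (2 * π * x) : ℝ) : ℂ) ≠ 0 := by exact_mod_cast (exp_pos _).ne'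
  have hx0 : (x : ℂ) ≠ 0 := by exact_mod_cast hx.ne'
  convert! h.mul_left Complex.I using 1
  · funext n
    have hp : (0 : ℝ) < x ^ 2 + (n + 1) ^ 2 := by positivity
    have hp' : (x : ℂ) ^ 2 + (n + 1) ^ 2 ≠ 0 := by exact_mod_cast hp.ne'
    have hfac : ((x : ℂ) * Complex.I - (n + 1)) * (x * Complex.I + (n + 1)) =
        -((x : ℂ) ^ 2 + (n + 1) ^ 2) := by
      linear_combination (x : ℂ) ^ 2 * Complex.I_sq
    have hne : ((x : ℂ) * Complex.I - (n + 1)) * (x * Complex.I + (n + 1)) ≠ 0 := by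
      rw [hfac]; exact neg_ne_zero.2 hp'
    have h1 := left_ne_zero_of_mul hne
    have h2 := right_ne_zero_of_mul hne
    rw [cotTerm, div_add_div _ _ h1 h2, hfac]
    push_cast
    field_simp
    linear_combination (2 * x : ℂ) * Complex.I_sq
  · rw [hE]
    generalize exp (2 * π * x) = E at *
    have h3 : (1 : ℂ) - (E : ℂ)⁻¹ ≠ 0 := by
      intro h
      apply hgt'
      field_simp at h
      simpa using h
    push_cast
    field_simp
    ring

/-- The partial fraction expansion of `tanh (t / 2) / 2`. -/
theorem hasSum_two_mul_div_sq_add_odd_mul_pi_sq {t : ℝ} (ht : 0 < t) :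
    HasSum (fun n : ℕ => 2 * t / (t ^ 2 + ((2 * n + 1) * π) ^ 2)) (1 / 2 - 1 / (exp t + 1)) := by
  have hpi := pi_pos
  have h1 := (hasSum_two_mul_div_sq_add_sq (x := t / (2 * π)) (by positivity)).mul_left (1 / (2 * π))
  have h2 := (hasSum_two_mul_div_sq_add_sq (x := t / π) (by positivity)).mul_left (1 / π)
  have h3 := h2.summable.comp_injective (i := fun n : ℕ => 2 * n)
    (mul_right_injective₀ two_ne_zero)
  have h4 := h2.unique (h3.hasSum.even_add_odd (f := fun n : ℕ => 1 / π *
    (2 * (t / π) / ((t / π) ^ 2 + ((n : ℝ) + 1) ^ 2))) (by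
      refine h1.congr_fun fun n => ?_
      push_cast
      field_simp
      ring))
  have h5 := h3.hasSum
  rw [← sub_eq_iff_eq_add.2 h4] at h5
  convert! h5 using 1
  · funext n
    simp only [Function.comp]
    push_cast
    field_simp
  · have e1 : 2 * π * (t / π) = t + t := by field_simp; ring
    have e2 : 2 * π * (t / (2 * π)) = t := by field_simp
    rw [e1, e2, Real.exp_add]
    have hgt : 1 < exp t := Real.one_lt_exp_iff.2 ht
    generalize exp t = E at *
    have h6 : E - 1 ≠ 0 := by linarith
    have h7 : E + 1 ≠ 0 := by linarith
    rw [show E * E - 1 = (E - 1) * (E + 1) by ring]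
    field_simp
    ring

theorem hasDerivAt_log_Gamma {x : ℝ} (hx : 0 < x) :
    HasDerivAt (fun y => log (Gamma y)) (deriv (fun y => log (Gamma y)) x) x := by
  have h := Real.differentiableAt_Gamma (s := x) fun m => by
    have : (0 : ℝ) ≤ m := m.cast_nonneg
    linarith
  exact (h.log (Gamma_pos_of_pos hx).ne').hasDerivAt

theorem deriv_log_Gamma_add_one {x : ℝ} (hx : 0 < x) :
    deriv (fun y => log (Gamma y)) (x + 1) = deriv (fun y => log (Gamma y)) x + 1 / x := by
  have h1 : HasDerivAt (fun y => log (Gamma (y + 1)))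
      (deriv (fun y => log (Gamma y)) (x + 1)) x :=
    (hasDerivAt_log_Gamma (by linarith : 0 < x + 1)).comp_add_const x 1
  have h2 := (hasDerivAt_log_Gamma hx).add (hasDerivAt_log hx.ne')
  rw [one_div]
  refine h1.unique (h2.congr_of_eventuallyEq ?_)
  filter_upwards [lt_mem_nhds hx] with y hy
  rw [Gamma_add_one hy.ne', log_mul hy.ne' (Gamma_pos_of_pos hy).ne', add_comm]
  rfl

theorem deriv_log_Gamma_add_nat {x : ℝ} (hx : 0 < x) (n : ℕ) :
    deriv (fun y => log (Gamma y)) (x + n) =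
      deriv (fun y => log (Gamma y)) x + ∑ k ∈ Finset.range n, 1 / (x + k) := by
  induction n with
  | zero => simp
  | succ n ih =>
    rw [Finset.sum_range_succ, ← add_assoc, ← ih, ← deriv_log_Gamma_add_one (by positivity)]
    push_cast
    ring_nf

theorem monotoneOn_deriv_log_Gamma : MonotoneOn (deriv fun y => log (Gamma y)) (Ioi 0) :=
  convexOn_log_Gamma.monotoneOn_deriv fun _ hx =>
    (hasDerivAt_log_Gamma hx).differentiableAt

theorem tendsto_deriv_log_Gamma_add_nat_sub_le {x y : ℝ} (hx : 0 < x) (hxy : x ≤ y) :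
    Tendsto (fun n : ℕ => deriv (fun y => log (Gamma y)) (y + n) -
      deriv (fun y => log (Gamma y)) (x + n)) atTop (𝓝 0) := by
  obtain ⟨N, hN⟩ := exists_nat_ge (y - x)
  have hlim : Tendsto (fun n : ℕ => ∑ k ∈ Finset.range N, 1 / (x + n + k)) atTop (𝓝 0) := by
    rw [← Finset.sum_const_zero (s := Finset.range N)]
    refine tendsto_finsetSum _ fun k _ => tendsto_const_nhds.div_atTop ?_
    exact tendsto_atTop_add_const_right _ _
      (tendsto_atTop_add_const_left _ _ tendsto_natCast_atTop_atTop)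
  refine tendsto_of_tendsto_of_tendsto_of_le_of_le tendsto_const_nhds hlim (fun n => ?_) fun n => ?_
  · have := monotoneOn_deriv_log_Gamma (a := x + n) (b := y + n) (by simp; positivity)
      (by have := hx.trans_le hxy; simp; positivity) (by linarith)
    simpa using this
  · have h1 : (0 : ℝ) < x + n := by positivity
    have := monotoneOn_deriv_log_Gamma (a := y + n) (b := x + n + N)
      (by have := hx.trans_le hxy; simp; positivity) (by simp; positivity) (by linarith)
    rw [deriv_log_Gamma_add_nat h1] at this
    simpa [add_comm] using this

theorem tendsto_deriv_log_Gamma_add_nat_sub {x y : ℝ} (hx : 0 < x) (hy : 0 < y) :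
    Tendsto (fun n : ℕ => deriv (fun y => log (Gamma y)) (y + n) -
      deriv (fun y => log (Gamma y)) (x + n)) atTop (𝓝 0) := by
  rcases le_total x y with h | h
  · exact tendsto_deriv_log_Gamma_add_nat_sub_le hx h
  · simpa using (tendsto_deriv_log_Gamma_add_nat_sub_le hy h).neg

theorem summable_one_div_add_nat_sq (x : ℝ) :
    Summable fun n : ℕ => 1 / (x + n) ^ 2 := by
  refine ((summable_one_div_nat_add_rpow x 2).2 one_lt_two).congr fun n => ?_
  rw [rpow_two, sq_abs, add_comm]

theorem hasSum_trigamma {x : ℝ} (hx : 0 < x) :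
    HasSum (fun n : ℕ => 1 / (x + n) ^ 2) (trigamma x) := by
  have hu := summable_one_div_add_nat_sq (x / 2)
  have hxt : x ∈ Ioi (x / 2) := half_lt_self hx
  have hg (n : ℕ) (y : ℝ) (hy : y ∈ Ioi (x / 2)) :
      HasDerivAt (fun y : ℝ => 1 / (x + n) - 1 / (y + n)) (1 / (y + n) ^ 2) y := by
    have hy' : 0 < y := (half_pos hx).trans hy
    have hne : y + n ≠ 0 := by positivity
    have := (((hasDerivAt_id y).add_const (n : ℝ)).fun_inv hne).const_sub (1 / (x + n))
    simpa [neg_div] using this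
  have hg' (n : ℕ) (y : ℝ) (hy : y ∈ Ioi (x / 2)) :
      ‖1 / (y + n) ^ 2‖ ≤ 1 / (x / 2 + n) ^ 2 := by
    have hy' : x / 2 < y := hy
    rw [Real.norm_of_nonneg (by positivity)]
    gcongr
  have hg0 : Summable fun n : ℕ => 1 / (x + n) - 1 / (x + n) := by simp
  have hd := hasDerivAt_tsum_of_isPreconnected hu isOpen_Ioi isPreconnected_Ioi hg hg' hxt hg0 hxt
  have heq : ∀ y ∈ Ioi (x / 2), deriv (fun y => log (Gamma y)) y =
      ∑' n : ℕ, (1 / (x + n) - 1 / (y + n)) + deriv (fun y => log (Gamma y)) x := by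
    intro y hy
    have hy' : 0 < y := (half_pos hx).trans hy
    have hs := summable_of_summable_hasDerivAt_of_isPreconnected hu isOpen_Ioi isPreconnected_Ioi
      hg hg' hxt hg0 hy
    have h1 := hs.hasSum.tendsto_sum_nat
    have h2 := (tendsto_deriv_log_Gamma_add_nat_sub hy' hx).add_const
      (deriv (fun y => log (Gamma y)) y - deriv (fun y => log (Gamma y)) x)
    have h3 := tendsto_nhds_unique h1 (h2.congr fun n => by
      rw [deriv_log_Gamma_add_nat hx, deriv_log_Gamma_add_nat hy', Finset.sum_sub_distrib]
      ring)
    rw [h3]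
    ring
  have hderiv : trigamma x = ∑' n : ℕ, 1 / (x + n) ^ 2 :=
    ((hd.add_const _).congr_of_eventuallyEq
      (eventually_of_mem (Ioi_mem_nhds (half_lt_self hx)) heq)).deriv
  rw [hderiv]
  exact (summable_one_div_add_nat_sq x).hasSum

theorem hasDerivAt_arctan_div_div {a : ℝ} (ha : 0 < a) (t : ℝ) :
    HasDerivAt (fun t => arctan (t / a) / a) (1 / (t ^ 2 + a ^ 2)) t := by
  convert! ((hasDerivAt_id t).div_const a).arctan.div_const a using 1
  simp only [id]
  field_simp
  ring

theorem tendsto_arctan_div_div {a : ℝ} (ha : 0 < a) :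
    Tendsto (fun t => arctan (t / a) / a) atTop (𝓝 (π / 2 / a)) :=
  ((tendsto_nhds_of_tendsto_nhdsWithin tendsto_arctan_atTop).comp
    (tendsto_id.atTop_div_const ha)).div_const a

theorem tendsto_div_sq_add_sq (a : ℝ) :
    Tendsto (fun t : ℝ => t / (t ^ 2 + a ^ 2)) atTop (𝓝 0) := by
  refine squeeze_zero' ?_ ?_ tendsto_inv_atTop_zero
  · filter_upwards [eventually_gt_atTop 0] with t ht
    positivity
  · filter_upwards [eventually_gt_atTop 0] with t ht
    rw [inv_eq_one_div, div_le_div_iff₀ (by positivity) ht]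
    nlinarith [sq_nonneg a]

theorem hasDerivAt_div_sq_add_sq {a : ℝ} (ha : 0 < a) (t : ℝ) :
    HasDerivAt (fun t : ℝ => t / (t ^ 2 + a ^ 2)) ((a ^ 2 - t ^ 2) / (t ^ 2 + a ^ 2) ^ 2) t := by
  convert! (hasDerivAt_id t).fun_div (((hasDerivAt_id t).fun_pow 2).add_const (a ^ 2))
    (by simp; positivity) using 1
  simp only [id]
  ring

theorem exists_primitive_sq_div {a b : ℝ} (ha : 0 < a) (hb : 0 < b) :
    ∃ G : ℝ → ℝ, G 0 = 0 ∧
      (∀ t, HasDerivAt G (t ^ 2 / ((t ^ 2 + a ^ 2) ^ 2 * (t ^ 2 + b ^ 2))) t) ∧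
      Tendsto G atTop (𝓝 (π / (4 * a * (a + b) ^ 2))) := by
  rcases eq_or_ne a b with rfl | hab
  · refine ⟨fun t => (arctan (t / a) / a + (t / (t ^ 2 + a ^ 2) -
      2 * a ^ 2 * ((t / (t ^ 2 + a ^ 2)) * (1 / (t ^ 2 + a ^ 2))))) / (8 * a ^ 2),
      by simp, fun t => ?_, ?_⟩
    · have hi : HasDerivAt (fun t : ℝ => 1 / (t ^ 2 + a ^ 2))
          (-(2 * t) / (t ^ 2 + a ^ 2) ^ 2) t := by
        have := (((hasDerivAt_id t).fun_pow 2).add_const (a ^ 2)).fun_inv (by simp; positivity)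
        simpa using this
      have h := (hasDerivAt_arctan_div_div ha t).fun_add ((hasDerivAt_div_sq_add_sq ha t).fun_sub
        (((hasDerivAt_div_sq_add_sq ha t).fun_mul hi).const_mul (2 * a ^ 2)))
      convert! h.div_const (8 * a ^ 2) using 1
      field_simp
      ring
    · have hi : Tendsto (fun t : ℝ => 1 / (t ^ 2 + a ^ 2)) atTop (𝓝 0) :=
        tendsto_const_nhds.div_atTop
          (tendsto_atTop_add_const_right _ _ (tendsto_pow_atTop two_ne_zero))
      have h := ((tendsto_arctan_div_div ha).add ((tendsto_div_sq_add_sq a).sub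
        (((tendsto_div_sq_add_sq a).mul hi).const_mul (2 * a ^ 2)))).div_const (8 * a ^ 2)
      convert! h using 2
      field_simp
      ring
  · have hd : a ^ 2 - b ^ 2 ≠ 0 := by
      rw [sq_sub_sq]
      exact mul_ne_zero (by positivity) (sub_ne_zero.2 hab)
    refine ⟨fun t => b ^ 2 / (a ^ 2 - b ^ 2) ^ 2 * (arctan (t / a) / a - arctan (t / b) / b) +
      1 / (2 * (a ^ 2 - b ^ 2)) * (t / (t ^ 2 + a ^ 2) + arctan (t / a) / a),
      by simp, fun t => ?_, ?_⟩
    · have h := (((hasDerivAt_arctan_div_div ha t).fun_sub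
        (hasDerivAt_arctan_div_div hb t)).const_mul (b ^ 2 / (a ^ 2 - b ^ 2) ^ 2)).fun_add
        (((hasDerivAt_div_sq_add_sq ha t).fun_add (hasDerivAt_arctan_div_div ha t)).const_mul
          (1 / (2 * (a ^ 2 - b ^ 2))))
      convert! h using 1
      field_simp
      ring
    · have h := (((tendsto_arctan_div_div ha).sub
        (tendsto_arctan_div_div hb)).const_mul (b ^ 2 / (a ^ 2 - b ^ 2) ^ 2)).add
        (((tendsto_div_sq_add_sq a).add (tendsto_arctan_div_div ha)).const_mul
          (1 / (2 * (a ^ 2 - b ^ 2))))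
      convert! h using 2
      rw [sq_sub_sq]
      have : a + b ≠ 0 := by positivity
      field_simp
      ring

theorem integrableOn_sq_div {a b : ℝ} (ha : 0 < a) (hb : 0 < b) :
    IntegrableOn (fun t => t ^ 2 / ((t ^ 2 + a ^ 2) ^ 2 * (t ^ 2 + b ^ 2))) (Ioi 0) := by
  obtain ⟨G, -, hG, hlim⟩ := exists_primitive_sq_div ha hb
  exact integrableOn_Ioi_deriv_of_nonneg' (fun t _ => hG t) (fun t _ => by positivity) hlim

theorem integral_sq_div {a b : ℝ} (ha : 0 < a) (hb : 0 < b) :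
    ∫ t in Ioi 0, t ^ 2 / ((t ^ 2 + a ^ 2) ^ 2 * (t ^ 2 + b ^ 2)) =
      π / (4 * a * (a + b) ^ 2) := by
  obtain ⟨G, hG0, hG, hlim⟩ := exists_primitive_sq_div ha hb
  rw [integral_Ioi_of_hasDerivAt_of_nonneg' (fun t _ => hG t) (fun t _ => by positivity) hlim,
    hG0, sub_zero]

theorem hasDerivAt_neg_inv_sq_add_sq_div_two {a : ℝ} (ha : 0 < a) (t : ℝ) :
    HasDerivAt (fun t : ℝ => -(t ^ 2 + a ^ 2)⁻¹ / 2) (t / (t ^ 2 + a ^ 2) ^ 2) t := by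
  convert! ((((hasDerivAt_id t).fun_pow 2).add_const (a ^ 2)).fun_inv
    (by simp; positivity)).fun_neg.div_const 2 using 1
  simp only [id]
  field_simp
  ring

theorem tendsto_neg_inv_sq_add_sq_div_two (a : ℝ) :
    Tendsto (fun t : ℝ => -(t ^ 2 + a ^ 2)⁻¹ / 2) atTop (𝓝 0) := by
  have : Tendsto (fun t : ℝ => (t ^ 2 + a ^ 2)⁻¹) atTop (𝓝 0) :=
    tendsto_inv_atTop_zero.comp
      (tendsto_atTop_add_const_right _ _ (tendsto_pow_atTop two_ne_zero))
  simpa using this.neg.div_const 2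

theorem integrableOn_div_sq_add_sq_sq {a : ℝ} (ha : 0 < a) :
    IntegrableOn (fun t => t / (t ^ 2 + a ^ 2) ^ 2) (Ioi 0) :=
  integrableOn_Ioi_deriv_of_nonneg' (fun t _ => hasDerivAt_neg_inv_sq_add_sq_div_two ha t)
    (fun t (ht : 0 < t) => by positivity) (tendsto_neg_inv_sq_add_sq_div_two a)

theorem integral_div_sq_add_sq_sq {a : ℝ} (ha : 0 < a) :
    ∫ t in Ioi 0, t / (t ^ 2 + a ^ 2) ^ 2 = 1 / (2 * a ^ 2) := by
  rw [integral_Ioi_of_hasDerivAt_of_nonneg' (fun t _ => hasDerivAt_neg_inv_sq_add_sq_div_two ha t)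
    (fun t (ht : 0 < t) => by positivity) (tendsto_neg_inv_sq_add_sq_div_two a)]
  simp
  ring

theorem hasSum_one_div_add_odd_mul_pi_sq {a : ℝ} (ha : 0 < a) :
    HasSum (fun n : ℕ => 1 / (a + (2 * n + 1) * π) ^ 2)
      (trigamma (a / π) / π ^ 2 - trigamma (a / (2 * π)) / (4 * π ^ 2)) := by
  have hpi := pi_pos
  have h1 := (hasSum_trigamma (x := a / π) (by positivity)).mul_left (1 / π ^ 2)
  have h2 := (hasSum_trigamma (x := a / (2 * π)) (by positivity)).mul_left (1 / (4 * π ^ 2))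
  have h3 := (h1.summable.comp_injective (i := fun n : ℕ => 2 * n + 1) fun m n h => by
    simpa using h).hasSum
  have h4 := h1.unique (HasSum.even_add_odd (f := fun n : ℕ => 1 / π ^ 2 * (1 / (a / π + n) ^ 2))
    (h2.congr_fun fun n => by
      push_cast
      field_simp
      ring) h3)
  rw [← sub_eq_iff_eq_add'.2 h4] at h3
  convert! h3 using 1
  · funext n
    simp only [Function.comp]
    push_cast
    field_simp
  · ring

theorem hasSum_div_sq_add_sq_sq_mul {a t : ℝ} (ht : 0 < t) :
    HasSum (fun n : ℕ => 2 * (t ^ 2 / ((t ^ 2 + a ^ 2) ^ 2 * (t ^ 2 + ((2 * n + 1) * π) ^ 2))))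
      (t / (t ^ 2 + a ^ 2) ^ 2 * (1 / 2 - 1 / (exp t + 1))) := by
  refine ((hasSum_two_mul_div_sq_add_odd_mul_pi_sq ht).mul_left _).congr_fun fun n => ?_
  rw [div_mul_div_comm]
  ring

theorem integral_div_sq_add_sq_sq_mul {a : ℝ} (ha : 0 < a) :
    ∫ t in Ioi 0, t / (t ^ 2 + a ^ 2) ^ 2 * (1 / 2 - 1 / (exp t + 1)) =
      π / (2 * a) * (trigamma (a / π) / π ^ 2 - trigamma (a / (2 * π)) / (4 * π ^ 2)) := by
  have hb (n : ℕ) : 0 < (2 * (n : ℝ) + 1) * π := by positivity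
  have hint (n : ℕ) : ∫ t in Ioi 0,
      2 * (t ^ 2 / ((t ^ 2 + a ^ 2) ^ 2 * (t ^ 2 + ((2 * (n : ℝ) + 1) * π) ^ 2))) =
      π / (2 * a) * (1 / (a + (2 * n + 1) * π) ^ 2) := by
    rw [integral_const_mul, integral_sq_div ha (hb n)]
    have := hb n
    field_simp
    ring
  have hsum := (hasSum_one_div_add_odd_mul_pi_sq ha).mul_left (π / (2 * a))
  have h := hasSum_integral_of_summable_integral_norm
    (fun n : ℕ => (integrableOn_sq_div ha (hb n)).const_mul 2) <| by
      refine hsum.summable.congr fun n => ?_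
      rw [← hint n]
      refine integral_congr_ae (ae_of_all _ fun t => ?_)
      exact (Real.norm_of_nonneg (by positivity)).symm
  simp only [hint] at h
  rw [← h.unique hsum]
  exact setIntegral_congr_fun measurableSet_Ioi fun t ht =>
    (hasSum_div_sq_add_sq_sq_mul ht).tsum_eq.symm

theorem integral_div_sq_add_sq_sq_mul_exp_add_one {a : ℝ} (ha : 0 < a) :
    ∫ t in Ioi 0, t / (t ^ 2 + a ^ 2) ^ 2 * (1 / (exp t + 1)) =
      1 / (4 * a ^ 2) -
        π / (2 * a) * (trigamma (a / π) / π ^ 2 - trigamma (a / (2 * π)) / (4 * π ^ 2)) := by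
  have hi := integrableOn_div_sq_add_sq_sq ha
  have hf : IntegrableOn (fun t => t / (t ^ 2 + a ^ 2) ^ 2 * (1 / 2 - 1 / (exp t + 1)))
      (Ioi 0) := by
    refine hi.mul_bdd (c := 1) (by measurability) (ae_of_all _ fun t => ?_)
    have h1 : 0 ≤ 1 / (exp t + 1) := by positivity
    have h2 : 1 / (exp t + 1) ≤ 1 := by
      rw [div_le_one (by positivity)]
      linarith [exp_pos t]
    rw [Real.norm_eq_abs, abs_le]
    constructor <;> linarith
  rw [← integral_div_sq_add_sq_sq_mul ha,
    show 1 / (4 * a ^ 2) = 1 / (2 * a ^ 2) * (1 / 2) by ring,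
    ← integral_div_sq_add_sq_sq ha, ← integral_mul_const, ← integral_sub (hi.mul_const _) hf]
  congr 1
  funext t
  ring

theorem image_exp_neg_Ioi : (fun t : ℝ => exp (-t)) '' Ioi 0 = Ioo 0 1 := by
  ext x
  constructor
  · rintro ⟨t, ht, rfl⟩
    exact ⟨exp_pos _, exp_lt_one_iff.2 (neg_lt_zero.2 ht)⟩
  · rintro ⟨h0, h1⟩
    exact ⟨-log x, neg_pos.2 (log_neg h0 h1), by simp [exp_log h0]⟩

theorem integral_zero_one_eq_integral_Ioi_exp_neg (f : ℝ → ℝ) :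
    ∫ x in (0 : ℝ)..1, f x = ∫ t in Ioi 0, exp (-t) * f (exp (-t)) := by
  have hd (t : ℝ) (_ : t ∈ Ioi 0) :
      HasDerivWithinAt (fun t : ℝ => exp (-t)) (-exp (-t)) (Ioi 0) t := by
    simpa using (hasDerivAt_neg t).exp.hasDerivWithinAt
  rw [intervalIntegral.integral_of_le zero_le_one, integral_Ioc_eq_integral_Ioo,
    ← image_exp_neg_Ioi, integral_image_eq_integral_abs_deriv_smul measurableSet_Ioi hd
      (fun x _ y _ h => neg_injective (exp_injective h))]
  simp

theorem bdh_integral_sixteen (a : ℝ) (ha : 0 < a) :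
    (∫ x in (0:ℝ)..1, Real.log x / ((a ^ 2 + Real.log x ^ 2) ^ 2 * (1 + x))) =
      -1 / (4 * a ^ 2) - (1 / (8 * a * π)) * trigamma (a / (2 * π)) +
        (1 / (2 * a * π)) * trigamma (a / π) := by
  rw [integral_zero_one_eq_integral_Ioi_exp_neg]
  have h (t : ℝ) : exp (-t) * (log (exp (-t)) / ((a ^ 2 + log (exp (-t)) ^ 2) ^ 2 *
      (1 + exp (-t)))) = -(t / (t ^ 2 + a ^ 2) ^ 2 * (1 / (exp t + 1))) := by
    rw [log_exp, exp_neg]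
    have := exp_pos t
    field_simp
    ring
  simp only [h]
  rw [integral_neg, integral_div_sq_add_sq_sq_mul_exp_add_one ha]
  field_simp
  ring
end

section
/- The integral ∫₀¹ (ln x)/((π² + (ln x)²)²·(1 + x)) dx equals 1/48 − 1/(4π²). -/
open Real MeasureTheory Set Filter Topology

lemma integral_sq_div_s16 {n : ℝ} (hn : 1 ≤ n) :
    IntegrableOn (fun s : ℝ => s ^ 2 / ((1 + s ^ 2) ^ 2 * (s ^ 2 + n ^ 2))) (Ioi 0) ∧
    ∫ s in Ioi (0:ℝ), s ^ 2 / ((1 + s ^ 2) ^ 2 * (s ^ 2 + n ^ 2)) = π / (4 * (n + 1) ^ 2) := by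
  suffices h : ∃ F : ℝ → ℝ, F 0 = 0 ∧ Tendsto F atTop (𝓝 (π / (4 * (n + 1) ^ 2))) ∧
      ∀ s, HasDerivAt F (s ^ 2 / ((1 + s ^ 2) ^ 2 * (s ^ 2 + n ^ 2))) s by
    obtain ⟨F, h0, hlim, hd⟩ := h
    have hpos : ∀ s ∈ Ioi (0:ℝ), 0 ≤ s ^ 2 / ((1 + s ^ 2) ^ 2 * (s ^ 2 + n ^ 2)) :=
      fun s _ => by positivity
    refine ⟨integrableOn_Ioi_deriv_of_nonneg' (fun s _ => hd s) hpos hlim, ?_⟩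
    rw [integral_Ioi_of_hasDerivAt_of_nonneg' (fun s _ => hd s) hpos hlim, h0, sub_zero]
  have hatan : Tendsto arctan atTop (𝓝 (π / 2)) :=
    tendsto_arctan_atTop.mono_right nhdsWithin_le_nhds
  have hinv : Tendsto (fun s : ℝ => s⁻¹) atTop (𝓝 0) := tendsto_inv_atTop_zero
  rcases hn.eq_or_lt with rfl | hn
  · refine ⟨fun s => (arctan s + s * (s ^ 2 - 1) / (1 + s ^ 2) ^ 2) / 8, by simp, ?_, ?_⟩
    · have h : Tendsto (fun s : ℝ => s⁻¹ * (1 - s⁻¹ ^ 2) / (1 + s⁻¹ ^ 2) ^ 2) atTop (𝓝 0) := by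
        have := (hinv.mul (tendsto_const_nhds (x := (1:ℝ)) |>.sub (hinv.pow 2))).div
          ((tendsto_const_nhds (x := (1:ℝ)) |>.add (hinv.pow 2)).pow 2) (by norm_num)
        simpa using! this
      have h2 := (hatan.add h).div_const 8
      convert h2.congr' ?_ using 2
      · ring
      · filter_upwards [eventually_gt_atTop 0] with s hs
        congr 2
        field_simp
        ring
    · intro s
      have h1 : (1 + s ^ 2) ≠ 0 := by positivity
      have := ((hasDerivAt_arctan s).add
        (((hasDerivAt_id s).mul (((hasDerivAt_id s).pow 2).sub_const 1)).div
          ((((hasDerivAt_id s).pow 2).const_add 1).pow 2) (pow_ne_zero 2 h1))).div_const 8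
      refine HasDerivAt.congr_deriv this ?_
      simp
      field_simp
      ring
  · have hN : n ^ 2 - 1 ≠ 0 := by nlinarith
    have hn0 : n ≠ 0 := by positivity
    refine ⟨fun s => n ^ 2 / (n ^ 2 - 1) ^ 2 * arctan s
      - 1 / (n ^ 2 - 1) * ((arctan s + s / (1 + s ^ 2)) / 2)
      - n / (n ^ 2 - 1) ^ 2 * arctan (s / n), by simp, ?_, ?_⟩
    · have h : Tendsto (fun s : ℝ => s⁻¹ / (1 + s⁻¹ ^ 2)) atTop (𝓝 0) := by
        have := hinv.div (tendsto_const_nhds (x := (1:ℝ)) |>.add (hinv.pow 2)) (by norm_num)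
        simpa using! this
      have h' : Tendsto (fun s : ℝ => s / (1 + s ^ 2)) atTop (𝓝 0) := by
        refine h.congr' ?_
        filter_upwards [eventually_gt_atTop 0] with s hs
        field_simp
        ring
      have h2 := ((hatan.const_mul (n ^ 2 / (n ^ 2 - 1) ^ 2)).sub
        (((hatan.add h').div_const 2).const_mul (1 / (n ^ 2 - 1)))).sub
        ((hatan.comp (tendsto_id.atTop_div_const (show 0 < n by positivity))).const_mul
          (n / (n ^ 2 - 1) ^ 2))
      refine Eq.subst (motive := fun l => Tendsto _ atTop (𝓝 l)) ?_ h2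
      have : n - 1 ≠ 0 := by linarith
      have h3 : n + 1 ≠ 0 := by linarith
      rw [show n ^ 2 - 1 = (n - 1) * (n + 1) by ring]
      field_simp
      ring
    · intro s
      have h1 : (1 + s ^ 2) ≠ 0 := by positivity
      have h3 : s ^ 2 + n ^ 2 ≠ 0 := by positivity
      have := (((hasDerivAt_arctan s).const_mul (n ^ 2 / (n ^ 2 - 1) ^ 2)).sub
        ((((hasDerivAt_arctan s).add ((hasDerivAt_id s).div
          (((hasDerivAt_id s).pow 2).const_add 1) h1)).div_const 2).const_mul
            (1 / (n ^ 2 - 1)))).sub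
        ((((hasDerivAt_id s).div_const n).arctan).const_mul (n / (n ^ 2 - 1) ^ 2))
      refine HasDerivAt.congr_deriv this ?_
      have h4 : 1 + (s / n) ^ 2 = (s ^ 2 + n ^ 2) / n ^ 2 := by field_simp; ring
      simp [h4]
      field_simp
      ring

lemma integral_div_sq :
    IntegrableOn (fun s : ℝ => s / (1 + s ^ 2) ^ 2) (Ioi 0) ∧
    ∫ s in Ioi (0:ℝ), s / (1 + s ^ 2) ^ 2 = 1 / 2 := by
  have hd : ∀ s : ℝ, HasDerivAt (fun s : ℝ => -(1 / 2) * (1 + s ^ 2)⁻¹) (s / (1 + s ^ 2) ^ 2) s := by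
    intro s
    have := ((((hasDerivAt_id s).pow 2).const_add 1).inv
      (show (1 + s ^ 2) ≠ 0 by positivity)).const_mul (-(1 / 2 : ℝ))
    refine HasDerivAt.congr_deriv this ?_
    simp
    ring
  have hlim : Tendsto (fun s : ℝ => -(1 / 2) * (1 + s ^ 2)⁻¹) atTop (𝓝 0) := by
    have : Tendsto (fun s : ℝ => 1 + s ^ 2) atTop atTop :=
      tendsto_atTop_add_const_left _ _ (tendsto_pow_atTop two_ne_zero)
    simpa using (tendsto_inv_atTop_zero.comp this).const_mul (-(1 / 2 : ℝ))
  have hpos : ∀ s ∈ Ioi (0:ℝ), 0 ≤ s / (1 + s ^ 2) ^ 2 :=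
    fun s hs => div_nonneg (le_of_lt hs) (by positivity)
  refine ⟨integrableOn_Ioi_deriv_of_nonneg' (fun s _ => hd s) hpos hlim, ?_⟩
  rw [integral_Ioi_of_hasDerivAt_of_nonneg' (fun s _ => hd s) hpos hlim]
  norm_num

lemma hasSum_div_sq_add_sq {s : ℝ} (hs : 0 < s) :
    HasSum (fun n : ℕ => s / (s ^ 2 + (n + 1) ^ 2))
      ((π * ((1 + exp (-(2 * π * s))) / (1 - exp (-(2 * π * s)))) - 1 / s) / 2) := by
  have hz : (s * Complex.I : ℂ) ∈ Complex.integerComplement := by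
    rw [Complex.mem_integerComplement_iff]
    rintro ⟨n, hn⟩
    have := congrArg Complex.im hn
    simp at this
    exact hs.ne this
  have h := (summable_cotTerm hz).hasSum
  rw [← cot_series_rep' hz, Complex.cot_eq_exp_ratio] at h
  have hE : 2 * Complex.I * (π * (s * Complex.I)) = ((-(2 * π * s) : ℝ) : ℂ) := by
    push_cast
    linear_combination (2 * π * s : ℂ) * Complex.I_mul_I
  rw [hE, ← Complex.ofReal_exp] at h
  have hlt : exp (-(2 * π * s)) < 1 := exp_lt_one_iff.2 (by nlinarith [mul_pos pi_pos hs])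
  set q := exp (-(2 * π * s))
  have hq : (1 - q : ℂ) ≠ 0 := by exact_mod_cast (sub_pos.2 hlt).ne'
  have hs' : (s : ℂ) ≠ 0 := by exact_mod_cast hs.ne'
  have h2 := h.mul_left (Complex.I / 2)
  rw [← Complex.hasSum_ofReal]
  convert! h2 using 1
  · ext n
    have h3 : (s ^ 2 + (n + 1) ^ 2 : ℂ) ≠ 0 := by
      exact_mod_cast (by positivity : (s ^ 2 + (n + 1) ^ 2 : ℝ) ≠ 0)
    have h4 : (s * Complex.I - (n + 1) : ℂ) * (s * Complex.I + (n + 1)) = -(s ^ 2 + (n + 1) ^ 2) := by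
      linear_combination (s ^ 2 : ℂ) * Complex.I_mul_I
    have h5 := cotTerm_identity hz n
    rw [h5, mul_comm _ (_ - _), h4]
    push_cast
    field_simp
    linear_combination (1 : ℂ) * Complex.I_mul_I
  · push_cast
    have := Complex.I_ne_zero
    field_simp
    ring

lemma hasSum_div_sq_add_odd_sq {s : ℝ} (hs : 0 < s) :
    HasSum (fun k : ℕ => s / (s ^ 2 + (2 * k + 1) ^ 2))
      (π / 2 * (1 / 2 - exp (-(π * s)) / (1 + exp (-(π * s))))) := by
  have h := hasSum_div_sq_add_sq hs
  have ho := (hasSum_div_sq_add_sq (half_pos hs)).div_const 2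
  have he : Summable fun k : ℕ => s / (s ^ 2 + (((2 * k : ℕ) : ℝ) + 1) ^ 2) :=
    h.summable.comp_injective (i := fun k : ℕ => 2 * k) (mul_right_injective₀ two_ne_zero)
  have hu := (he.hasSum.even_add_odd (f := fun n : ℕ => s / (s ^ 2 + ((n : ℝ) + 1) ^ 2))
    (by
      convert! ho using 1
      ext k
      push_cast
      field_simp
      ring)).unique h
  convert! he.hasSum using 1
  · simp
  · rw [← eq_sub_iff_add_eq] at hu
    rw [hu]
    have e1 : exp (-(2 * π * s)) = exp (-(π * s)) ^ 2 := by
      rw [← exp_nat_mul]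
      congr 1
      push_cast
      ring
    have e2 : -(2 * π * (s / 2)) = -(π * s) := by ring
    rw [e1, e2]
    have hlt : exp (-(π * s)) < 1 := exp_lt_one_iff.2 (by nlinarith [mul_pos pi_pos hs])
    have hpos := exp_pos (-(π * s))
    generalize exp (-(π * s)) = q at *
    have h1 : 1 - q ≠ 0 := by linarith
    have h2 : 1 + q ≠ 0 := by linarith
    rw [show 1 - q ^ 2 = (1 - q) * (1 + q) by ring]
    field_simp
    ring

lemma integral_div_sq_mul_half_sub :
    IntegrableOn (fun s : ℝ => s / (1 + s ^ 2) ^ 2 *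
      (1 / 2 - exp (-(π * s)) / (1 + exp (-(π * s))))) (Ioi 0) ∧
    ∫ s in Ioi (0:ℝ), s / (1 + s ^ 2) ^ 2 * (1 / 2 - exp (-(π * s)) / (1 + exp (-(π * s)))) =
      π ^ 2 / 48 := by
  have hk (k : ℕ) := integral_sq_div_s16 (n := 2 * k + 1) (by linarith [k.cast_nonneg (α := ℝ)])
  have hval (k : ℕ) : π / (4 * ((2 * k + 1 : ℝ) + 1) ^ 2) = π / 16 * (1 / ((k + 1 : ℕ) : ℝ) ^ 2) := by
    push_cast
    field_simp
    ring
  have hz : HasSum (fun k : ℕ => π / 16 * (1 / ((k + 1 : ℕ) : ℝ) ^ 2)) (π / 16 * (π ^ 2 / 6)) := by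
    refine HasSum.mul_left _ ?_
    have := (hasSum_nat_add_iff' 1).2 hasSum_zeta_two
    simpa using this
  have hsum := hasSum_integral_of_summable_integral_norm (fun k => (hk k).1) (by
    refine hz.summable.congr fun k => ?_
    rw [← hval, ← (hk k).2]
    refine integral_congr_ae (.of_forall fun s => ?_)
    exact (norm_of_nonneg (by positivity)).symm)
  have htsum (s : ℝ) (hs : s ∈ Ioi (0:ℝ)) :
      ∑' k : ℕ, s ^ 2 / ((1 + s ^ 2) ^ 2 * (s ^ 2 + (2 * k + 1) ^ 2)) =
        π / 2 * (s / (1 + s ^ 2) ^ 2 * (1 / 2 - exp (-(π * s)) / (1 + exp (-(π * s))))) := by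
    rw [mul_left_comm, ← ((hasSum_div_sq_add_odd_sq hs).mul_left (s / (1 + s ^ 2) ^ 2)).tsum_eq]
    congr 1 with k
    field_simp
  simp only [(hk _).2, hval] at hsum
  rw [setIntegral_congr_fun measurableSet_Ioi htsum, integral_const_mul] at hsum
  have hI := hsum.unique hz
  have := pi_pos
  have hI : ∫ s in Ioi (0:ℝ), s / (1 + s ^ 2) ^ 2 *
      (1 / 2 - exp (-(π * s)) / (1 + exp (-(π * s)))) = π ^ 2 / 48 := by
    field_simp at hI ⊢
    linarith
  refine ⟨?_, hI⟩
  by_contra hn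
  rw [integral_undef hn] at hI
  have : 0 < π ^ 2 / 48 := by positivity
  linarith

lemma image_exp_neg_pi_mul : (fun s => exp (-(π * s))) '' Ioi 0 = Ioo 0 1 := by
  ext x
  simp only [mem_image, mem_Ioi, mem_Ioo]
  constructor
  · rintro ⟨s, hs, rfl⟩
    exact ⟨exp_pos _, exp_lt_one_iff.2 (by nlinarith [mul_pos pi_pos hs])⟩
  · rintro ⟨h0, h1⟩
    refine ⟨-log x / π, div_pos (neg_pos.2 (log_neg h0 h1)) pi_pos, ?_⟩
    rw [mul_div_cancel₀ _ pi_ne_zero, neg_neg, exp_log h0]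

theorem bdh_integral_seventeen :
    (∫ x in (0:ℝ)..1, Real.log x / ((π ^ 2 + Real.log x ^ 2) ^ 2 * (1 + x))) =
      1 / 48 - 1 / (4 * π ^ 2) := by
  rw [intervalIntegral.integral_of_le zero_le_one, integral_Ioc_eq_integral_Ioo,
    ← image_exp_neg_pi_mul,
    integral_image_eq_integral_abs_deriv_smul (f' := fun s => exp (-(π * s)) * -π)
      measurableSet_Ioi
      (fun s _ => by
        have := (((hasDerivAt_id s).const_mul π).neg).exp
        simpa using! this.hasDerivWithinAt)
      (fun a _ b _ hab => by simpa [pi_ne_zero] using! hab)]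
  have hint (s : ℝ) : |exp (-(π * s)) * -π| • (log (exp (-(π * s))) /
      ((π ^ 2 + log (exp (-(π * s))) ^ 2) ^ 2 * (1 + exp (-(π * s))))) =
      1 / π ^ 2 * (s / (1 + s ^ 2) ^ 2 * (1 / 2 - exp (-(π * s)) / (1 + exp (-(π * s))))
        - 1 / 2 * (s / (1 + s ^ 2) ^ 2)) := by
    have hpos := exp_pos (-(π * s))
    rw [log_exp, abs_mul, abs_neg, abs_of_pos hpos, abs_of_pos pi_pos, smul_eq_mul]
    generalize exp (-(π * s)) = q at *
    have := pi_pos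
    rw [show π ^ 2 + (-(π * s)) ^ 2 = π ^ 2 * (1 + s ^ 2) by ring]
    field_simp
    ring
  simp only [hint]
  rw [integral_const_mul, integral_sub integral_div_sq_mul_half_sub.1
    (integral_div_sq.1.const_mul _), integral_div_sq_mul_half_sub.2, integral_const_mul,
    integral_div_sq.2]
  field_simp
  ring
end

section
/- The integrals ∫₀¹ 1/((π² + (ln x)²)²·(1 + x)²) dx and ∫₁^∞ 1/((π² + (ln x)²)²·(1 + x)²) dx are both equal to (ζ(3) + ζ(2))/(8π⁴). -/
open Real MeasureTheory

open Set Filter Topology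

lemma integrableOn_Ioi_pow_mul_exp_neg_mul (n : ℕ) {r : ℝ} (hr : 0 < r) :
    IntegrableOn (fun t : ℝ => t ^ n * exp (-(r * t))) (Ioi 0) := by
  have h := integrableOn_rpow_mul_exp_neg_mul_rpow (p := 1) (s := n) (b := r)
    (by have : (0 : ℝ) ≤ n := n.cast_nonneg
        linarith) one_pos hr
  simpa [rpow_natCast] using h

lemma integral_Ioi_pow_mul_exp_neg_mul (n : ℕ) {r : ℝ} (hr : 0 < r) :
    ∫ t in Ioi (0 : ℝ), t ^ n * exp (-(r * t)) = n.factorial / r ^ (n + 1) := by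
  have h := integral_rpow_mul_exp_neg_mul_Ioi (a := (n : ℝ) + 1) (r := r) (by positivity) hr
  simp only [add_sub_cancel_right, rpow_natCast, Real.Gamma_nat_eq_factorial] at h
  rw [h, ← Nat.cast_add_one, rpow_natCast, one_div, inv_pow]
  field_simp

lemma integrableOn_Ioi_one_add_mul_exp_neg_mul {a : ℝ} (ha : 0 < a) :
    IntegrableOn (fun t : ℝ => (1 + a * t) * exp (-(a * t))) (Ioi 0) := by
  have h := (integrableOn_Ioi_pow_mul_exp_neg_mul 0 ha).add
    ((integrableOn_Ioi_pow_mul_exp_neg_mul 1 ha).const_mul a)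
  refine h.congr_fun (fun t _ => ?_) measurableSet_Ioi
  simp only [Pi.add_apply]
  ring

/-- The Laplace-type representation of `2 a³ / (a² + b²)²`, up to an imaginary part. -/
lemma integral_Ioi_one_add_mul_exp_neg_mul_cexp {a : ℝ} (ha : 0 < a) (b : ℝ) :
    ∫ t in Ioi (0 : ℝ), (((1 + a * t) * exp (-(a * t)) : ℝ) : ℂ) * Complex.exp (Complex.I * t * b)
      = 1 / (a - Complex.I * b) + a / (a - Complex.I * b) ^ 2 := by
  set r : ℂ := a - Complex.I * b with hr
  have hr0 : r ≠ 0 := by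
    intro h
    have := congrArg Complex.re h
    simp [hr] at this
    exact ha.ne' this
  have hint := integrableOn_Ioi_one_add_mul_exp_neg_mul ha
  have hexp : ∀ t : ℝ, (((1 + a * t) * exp (-(a * t)) : ℝ) : ℂ) * Complex.exp (Complex.I * t * b)
      = (1 + a * t) * Complex.exp (-(r * t)) := by
    intro t
    push_cast
    rw [mul_assoc, ← Complex.exp_add, hr]
    congr 2
    ring
  have hd : ∀ t : ℝ, HasDerivAt
      (fun t : ℝ => -((1 + a * (t : ℂ)) / r + a / r ^ 2) * Complex.exp (-(r * t)))
      ((1 + a * t) * Complex.exp (-(r * t))) t := by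
    intro t
    have h1 : HasDerivAt (fun t : ℂ => -((1 + a * t) / r + a / r ^ 2) * Complex.exp (-(r * t)))
        ((1 + a * t) * Complex.exp (-(r * t))) (t : ℂ) := by
      have e1 : HasDerivAt (fun t : ℂ => -((1 + a * t) / r + a / r ^ 2)) (-(a / r)) (t : ℂ) := by
        have := ((((hasDerivAt_id (t : ℂ)).const_mul (a : ℂ)).const_add 1).div_const r).add_const
          ((a : ℂ) / r ^ 2)
        simpa using this.fun_neg
      have e2 : HasDerivAt (fun t : ℂ => Complex.exp (-(r * t)))
          (Complex.exp (-(r * t)) * -r) (t : ℂ) := by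
        have := ((hasDerivAt_id (t : ℂ)).const_mul r).neg
        simpa using this.cexp
      convert! e1.mul e2 using 1
      field_simp
      ring
    exact h1.comp_ofReal
  have hint' : IntegrableOn (fun t : ℝ => (1 + a * (t : ℂ)) * Complex.exp (-(r * t))) (Ioi 0) := by
    refine Integrable.mono' hint.norm (by fun_prop) (ae_of_all _ fun t => ?_)
    rw [← hexp, norm_mul, show Complex.I * t * b = ((t * b : ℝ) : ℂ) * Complex.I by
      push_cast; ring, Complex.norm_exp_ofReal_mul_I, mul_one, Complex.norm_real]
  have hlim : Tendsto
      (fun t : ℝ => -((1 + a * (t : ℂ)) / r + a / r ^ 2) * Complex.exp (-(r * t))) atTop (𝓝 0) := by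
    have hexp0 : Tendsto (fun t : ℝ => exp (-(a * t))) atTop (𝓝 0) :=
      tendsto_exp_neg_atTop_nhds_zero.comp (tendsto_id.const_mul_atTop ha)
    have hexp1 : Tendsto (fun t : ℝ => a * t * exp (-(a * t))) atTop (𝓝 0) := by
      have := (tendsto_pow_mul_exp_neg_atTop_nhds_zero 1).comp (tendsto_id.const_mul_atTop ha)
      simpa [Function.comp_def] using this
    have hn : ∀ t : ℝ, ‖Complex.exp (-(r * t))‖ = exp (-(a * t)) := by
      intro t
      rw [Complex.norm_exp]
      simp [hr]
    have h0 : Tendsto (fun t : ℝ => Complex.exp (-(r * t))) atTop (𝓝 0) := by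
      rw [tendsto_zero_iff_norm_tendsto_zero]
      simpa only [hn] using hexp0
    have h1 : Tendsto (fun t : ℝ => a * (t : ℂ) * Complex.exp (-(r * t))) atTop (𝓝 0) := by
      rw [tendsto_zero_iff_norm_tendsto_zero]
      have := hexp1.norm
      simpa only [norm_mul, hn, Complex.norm_real, norm_zero, Real.norm_eq_abs, abs_exp] using this
    have := (h0.const_mul (-(1 / r + a / r ^ 2))).add (h1.const_mul (-(1 / r)))
    simp only [mul_zero, add_zero] at this
    refine this.congr fun t => ?_
    ring
  simp_rw [hexp]
  rw [integral_Ioi_of_hasDerivAt_of_tendsto' (fun t _ => hd t) hint' hlim]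
  simp

/-- The Fourier transform of the logistic distribution, written over the unit interval. -/
lemma integral_Ioo_cexp_mul_log_div_one_sub {t : ℝ} (ht : 0 < t) :
    ∫ y in Ioo (0 : ℝ) 1, Complex.exp (Complex.I * t * (log (y / (1 - y)) : ℝ))
      = ((π * t / sinh (π * t) : ℝ) : ℂ) := by
  have h : Complex.betaIntegral (1 + Complex.I * t) (1 - Complex.I * t)
      = ∫ y in Ioo (0 : ℝ) 1, Complex.exp (Complex.I * t * (log (y / (1 - y)) : ℝ)) := by
    rw [Complex.betaIntegral, intervalIntegral.integral_of_le zero_le_one,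
      integral_Ioc_eq_integral_Ioo]
    refine setIntegral_congr_fun measurableSet_Ioo fun y hy => ?_
    have h0 : (0 : ℝ) < y := hy.1
    have h1 : (0 : ℝ) < 1 - y := sub_pos.2 hy.2
    rw [show (1 : ℂ) - (y : ℂ) = ((1 - y : ℝ) : ℂ) by push_cast; ring,
      Complex.cpow_def_of_ne_zero (by exact_mod_cast h0.ne'),
      Complex.cpow_def_of_ne_zero (by exact_mod_cast h1.ne'), ← Complex.ofReal_log h0.le,
      ← Complex.ofReal_log h1.le, ← Complex.exp_add, log_div h0.ne' h1.ne']
    congr 1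
    push_cast
    ring
  have hI : Complex.I * (t : ℂ) ≠ 0 :=
    mul_ne_zero Complex.I_ne_zero (by exact_mod_cast ht.ne')
  have hB := Complex.Gamma_mul_Gamma_eq_betaIntegral (s := 1 + Complex.I * t)
    (t := 1 - Complex.I * t) (by simp) (by simp)
  rw [show (1 + Complex.I * t + (1 - Complex.I * t) : ℂ) = 1 + 1 by ring,
    Complex.Gamma_add_one 1 one_ne_zero, Complex.Gamma_one, one_mul, one_mul, h,
    add_comm (1 : ℂ), Complex.Gamma_add_one _ hI, mul_assoc, Complex.Gamma_mul_Gamma_one_sub] at hB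
  rw [← hB, show (π : ℂ) * (Complex.I * t) = (π * t : ℝ) * Complex.I by push_cast; ring,
    Complex.sin_mul_I, ← Complex.ofReal_sinh]
  have hs : ((sinh (π * t) : ℝ) : ℂ) ≠ 0 := by
    exact_mod_cast (sinh_pos_iff.2 (by positivity)).ne'
  push_cast at hs ⊢
  field_simp

lemma integral_Ioi_one_add_mul_exp_neg_mul_div_sinh :
    ((∫ t in Ioi (0 : ℝ), (1 + π * t) * exp (-(π * t)) * (π * t / sinh (π * t)) : ℝ) : ℂ)
      = (riemannZeta 3 + riemannZeta 2) / (2 * π) := by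
  set F : ℕ → ℝ → ℝ := fun n t =>
    2 * π * (t ^ 1 * exp (-((2 * π * (n + 1)) * t))) +
      2 * π ^ 2 * (t ^ 2 * exp (-((2 * π * (n + 1)) * t))) with hF
  have hp : ∀ n : ℕ, 0 < 2 * π * ((n : ℝ) + 1) := fun n => by positivity
  have hi1 := fun n : ℕ => (integrableOn_Ioi_pow_mul_exp_neg_mul 1 (hp n)).const_mul (2 * π)
  have hi2 := fun n : ℕ => (integrableOn_Ioi_pow_mul_exp_neg_mul 2 (hp n)).const_mul (2 * π ^ 2)
  have hFi : ∀ n, IntegrableOn (F n) (Ioi 0) := fun n => (hi1 n).add (hi2 n)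
  have hval : ∀ n : ℕ, ∫ t in Ioi (0 : ℝ), F n t
      = (1 / ((n : ℝ) + 1) ^ 3 + 1 / ((n : ℝ) + 1) ^ 2) / (2 * π) := by
    intro n
    rw [hF, integral_add (hi1 n) (hi2 n), integral_const_mul, integral_const_mul,
      integral_Ioi_pow_mul_exp_neg_mul 1 (hp n), integral_Ioi_pow_mul_exp_neg_mul 2 (hp n)]
    simp only [Nat.factorial]
    push_cast
    field_simp
    ring
  have hnorm : ∀ n : ℕ, ∫ t in Ioi (0 : ℝ), ‖F n t‖ = ∫ t in Ioi (0 : ℝ), F n t := by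
    intro n
    refine setIntegral_congr_fun measurableSet_Ioi fun t ht => ?_
    have : (0 : ℝ) < t := ht
    exact Real.norm_of_nonneg (by simp only [hF]; positivity)
  have hs : ∀ k : ℕ, 1 < k → Summable fun n : ℕ => 1 / ((n : ℝ) + 1) ^ k := by
    intro k hk
    have := (summable_nat_add_iff 1).2 (Real.summable_one_div_nat_pow.2 hk)
    simpa using this
  have hz : ∀ k : ℕ, 1 < k →
      HasSum (fun n : ℕ => ((1 / ((n : ℝ) + 1) ^ k : ℝ) : ℂ)) (riemannZeta k) := by
    intro k hk
    rw [zeta_eq_tsum_one_div_nat_add_one_cpow (by simpa using hk)]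
    have := (Complex.ofRealCLM.summable (hs k hk)).hasSum
    simpa [Function.comp_def] using this
  have hsum := hasSum_integral_of_summable_integral_norm hFi (by
    simp_rw [hnorm, hval]
    exact ((hs 3 (by norm_num)).add (hs 2 (by norm_num))).div_const _)
  have htsum : ∫ t in Ioi (0 : ℝ), (∑' n, F n t)
      = ∫ t in Ioi (0 : ℝ), (1 + π * t) * exp (-(π * t)) * (π * t / sinh (π * t)) := by
    refine setIntegral_congr_fun measurableSet_Ioi fun t ht => ?_
    have ht : (0 : ℝ) < t := ht
    have hlt : exp (-(2 * π * t)) < 1 := Real.exp_lt_one_iff.2 (by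
      have : 0 < 2 * π * t := by positivity
      linarith)
    have hg := (hasSum_geometric_of_lt_one (exp_pos (-(2 * π * t))).le hlt).mul_left
      ((2 * π * t + 2 * π ^ 2 * t ^ 2) * exp (-(2 * π * t)))
    have hFt : (fun n => F n t) = fun n : ℕ =>
        (2 * π * t + 2 * π ^ 2 * t ^ 2) * exp (-(2 * π * t)) * exp (-(2 * π * t)) ^ n := by
      funext n
      rw [mul_assoc, ← pow_succ', ← Real.exp_nat_mul]
      simp only [hF]
      rw [show ((n + 1 : ℕ) : ℝ) * -(2 * π * t) = -(2 * π * (n + 1) * t) by push_cast; ring]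
      ring
    rw [hFt, hg.tsum_eq, sinh_eq]
    have hE : exp (-(2 * π * t)) = exp (-(π * t)) ^ 2 := by
      rw [← Real.exp_nat_mul]
      congr 1
      push_cast
      ring
    have hE' : exp (π * t) = (exp (-(π * t)))⁻¹ := by rw [exp_neg, inv_inv]
    rw [hE] at hlt ⊢
    rw [hE']
    have he := exp_pos (-(π * t))
    generalize exp (-(π * t)) = e at *
    have h1 : 1 - e ^ 2 ≠ 0 := by linarith
    have h2 : e⁻¹ - e = (1 - e ^ 2) / e := by field_simp
    rw [h2]
    field_simp
  rw [htsum] at hsum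
  simp_rw [hval] at hsum
  have hC := Complex.ofRealCLM.hasSum hsum
  have hzz := ((hz 3 (by norm_num)).add (hz 2 (by norm_num))).div_const (2 * π : ℂ)
  refine hC.unique ?_
  convert! hzz using 2 with n
  simp

lemma integral_Ioo_one_div_sq_add_log_sq_sq :
    ((∫ y in Ioo (0 : ℝ) 1, 1 / (π ^ 2 + log (y / (1 - y)) ^ 2) ^ 2 : ℝ) : ℂ)
      = (riemannZeta 3 + riemannZeta 2) / (4 * (π : ℂ) ^ 4) := by
  set L : ℝ → ℝ := fun y => log (y / (1 - y)) with hL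
  have hLm : Measurable L := by
    simp only [hL]
    fun_prop
  set g : ℝ → ℝ := fun t => (1 + π * t) * exp (-(π * t)) with hg
  have hgi : IntegrableOn g (Ioi 0) := integrableOn_Ioi_one_add_mul_exp_neg_mul pi_pos
  have hK : Integrable (Function.uncurry fun y t : ℝ =>
      (g t : ℂ) * Complex.exp (Complex.I * t * (L y : ℝ)))
      ((volume.restrict (Ioo (0 : ℝ) 1)).prod (volume.restrict (Ioi (0 : ℝ)))) := by
    have h1 : Integrable (fun _ : ℝ => (1 : ℂ)) (volume.restrict (Ioo (0 : ℝ) 1)) :=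
      integrable_const 1
    have h2 : Integrable (fun t => (g t : ℂ)) (volume.restrict (Ioi (0 : ℝ))) := hgi.ofReal
    refine (h1.mul_prod h2).mono ?_ (ae_of_all _ fun z => ?_)
    · refine Measurable.aestronglyMeasurable ?_
      simp only [hg, Function.uncurry_def]
      fun_prop
    · simp only [Function.uncurry_def, norm_mul, one_mul]
      rw [show Complex.I * z.2 * (L z.1 : ℝ) = ((z.2 * L z.1 : ℝ) : ℂ) * Complex.I by
        push_cast; ring, Complex.norm_exp_ofReal_mul_I, mul_one]
  have hswap := integral_integral_swap hK
  have hlhs : ∀ y : ℝ, (∫ t in Ioi (0 : ℝ), (g t : ℂ) * Complex.exp (Complex.I * t * (L y : ℝ))).re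
      = 2 * π ^ 3 * (1 / (π ^ 2 + L y ^ 2) ^ 2) := by
    intro y
    rw [hg, integral_Ioi_one_add_mul_exp_neg_mul_cexp pi_pos]
    have hD : 0 < π ^ 2 + L y ^ 2 := by positivity
    have hr : ((π : ℂ) - Complex.I * (L y : ℝ)) * (π + Complex.I * (L y : ℝ))
        = ((π ^ 2 + L y ^ 2 : ℝ) : ℂ) := by
      push_cast
      linear_combination (-(L y : ℂ) ^ 2) * Complex.I_sq
    have hD' : ((π ^ 2 + L y ^ 2 : ℝ) : ℂ) ≠ 0 := by exact_mod_cast hD.ne'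
    have hinv : 1 / ((π : ℂ) - Complex.I * (L y : ℝ))
        = (π + Complex.I * (L y : ℝ)) * (((π ^ 2 + L y ^ 2)⁻¹ : ℝ) : ℂ) := by
      rw [Complex.ofReal_inv, ← hr]
      have : (π : ℂ) + Complex.I * (L y : ℝ) ≠ 0 := fun h => by
        rw [h, mul_zero] at hr
        exact hD' hr.symm
      field_simp
    rw [show (π : ℂ) / ((π : ℂ) - Complex.I * (L y : ℝ)) ^ 2
      = π * (1 / ((π : ℂ) - Complex.I * (L y : ℝ))) ^ 2 by rw [one_div, inv_pow, div_eq_mul_inv],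
      hinv]
    simp [pow_two, -Complex.ofReal_inv, -Complex.ofReal_add]
    field_simp
    ring
  have hrhs : ∫ t in Ioi (0 : ℝ), ∫ y in Ioo (0 : ℝ) 1,
      (g t : ℂ) * Complex.exp (Complex.I * t * (L y : ℝ))
      = ((∫ t in Ioi (0 : ℝ), g t * (π * t / sinh (π * t)) : ℝ) : ℂ) := by
    rw [← integral_complex_ofReal]
    refine setIntegral_congr_fun measurableSet_Ioi fun t ht => ?_
    rw [integral_const_mul, hL, integral_Ioo_cexp_mul_log_div_one_sub ht]
    simp
  rw [hrhs] at hswap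
  have hre := congrArg Complex.re hswap
  rw [Complex.ofReal_re] at hre
  have h3 := integral_re hK.integral_prod_left
  simp only [Function.uncurry_apply_pair, RCLike.re_eq_complex_re] at h3
  rw [← h3] at hre
  simp_rw [hlhs] at hre
  rw [integral_const_mul] at hre
  have hfin := integral_Ioi_one_add_mul_exp_neg_mul_div_sinh
  rw [← hre] at hfin
  have hpi : (π : ℂ) ≠ 0 := by exact_mod_cast pi_ne_zero
  rw [Complex.ofReal_mul] at hfin
  push_cast at hfin
  field_simp at hfin ⊢
  linear_combination hfin

theorem bdh_integral_nineteen :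
    (((∫ x in (0:ℝ)..1, 1 / ((π ^ 2 + Real.log x ^ 2) ^ 2 * (1 + x) ^ 2) : ℝ)) : ℂ) =
      (riemannZeta 3 + riemannZeta 2) / (8 * (π : ℂ) ^ 4) ∧
    (((∫ x in Set.Ioi (1:ℝ), 1 / ((π ^ 2 + Real.log x ^ 2) ^ 2 * (1 + x) ^ 2) : ℝ)) : ℂ) =
      (riemannZeta 3 + riemannZeta 2) / (8 * (π : ℂ) ^ 4) := by
  set f : ℝ → ℝ := fun x => 1 / ((π ^ 2 + Real.log x ^ 2) ^ 2 * (1 + x) ^ 2) with hf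
  have himg : (fun y : ℝ => y / (1 - y)) '' Ioo 0 1 = Ioi 0 := by
    ext x
    constructor
    · rintro ⟨y, hy, rfl⟩
      exact div_pos hy.1 (sub_pos.2 hy.2)
    · intro hx
      have hx : (0 : ℝ) < x := hx
      refine ⟨x / (1 + x), ⟨by positivity, by rw [div_lt_one (by positivity)]; linarith⟩, ?_⟩
      have : 1 - x / (1 + x) = 1 / (1 + x) := by field_simp; ring
      simp only [this]
      field_simp
  have hder : ∀ y ∈ Ioo (0 : ℝ) 1, HasDerivWithinAt (fun y : ℝ => y / (1 - y))
      (1 / (1 - y) ^ 2) (Ioo 0 1) y := by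
    intro y hy
    have h1 : 1 - y ≠ 0 := (sub_pos.2 hy.2).ne'
    have := (hasDerivAt_id y).div ((hasDerivAt_id y).const_sub 1) h1
    convert! this.hasDerivWithinAt using 1
    simp
  have hinj : InjOn (fun y : ℝ => y / (1 - y)) (Ioo 0 1) := by
    intro x hx y hy h
    have h1 : 1 - x ≠ 0 := (sub_pos.2 hx.2).ne'
    have h2 : 1 - y ≠ 0 := (sub_pos.2 hy.2).ne'
    simp only at h
    rw [div_eq_div_iff h1 h2] at h
    linarith
  have hcomp : EqOn (fun y : ℝ => |1 / (1 - y) ^ 2| • f (y / (1 - y)))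
      (fun y => 1 / (π ^ 2 + log (y / (1 - y)) ^ 2) ^ 2) (Ioo 0 1) := by
    intro y hy
    have h1 : 0 < 1 - y := sub_pos.2 hy.2
    have h2 : 1 + y / (1 - y) = 1 / (1 - y) := by field_simp; ring
    simp only [hf, smul_eq_mul, h2]
    rw [abs_of_pos (by positivity)]
    field_simp
  have hint : IntegrableOn f (Ioi 0) := by
    rw [← himg, integrableOn_image_iff_integrableOn_abs_deriv_smul measurableSet_Ioo hder hinj,
      integrableOn_congr_fun hcomp measurableSet_Ioo]
    refine Measure.integrableOn_of_bounded (M := 1 / (π ^ 2) ^ 2) (by simp)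
      (Measurable.aestronglyMeasurable (by fun_prop)) (ae_of_all _ fun y => ?_)
    rw [Real.norm_of_nonneg (by positivity)]
    gcongr
    nlinarith [sq_nonneg (log (y / (1 - y)))]
  have htot : ∫ x in Ioi (0 : ℝ), f x
      = ∫ y in Ioo (0 : ℝ) 1, 1 / (π ^ 2 + log (y / (1 - y)) ^ 2) ^ 2 := by
    rw [← himg, integral_image_eq_integral_abs_deriv_smul measurableSet_Ioo hder hinj]
    exact setIntegral_congr_fun measurableSet_Ioo hcomp
  have hsplit : ∫ x in Ioi (0 : ℝ), f x = (∫ x in Ioc (0 : ℝ) 1, f x) + ∫ x in Ioi (1 : ℝ), f x := by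
    rw [← Ioc_union_Ioi_eq_Ioi zero_le_one]
    exact setIntegral_union Ioc_disjoint_Ioi_same measurableSet_Ioi
      (hint.mono_set Ioc_subset_Ioi_self) (hint.mono_set (Ioi_subset_Ioi zero_le_one))
  have himg' : (fun x : ℝ => x⁻¹) '' Ioi 1 = Ioo 0 1 := by
    ext x
    constructor
    · rintro ⟨y, hy, rfl⟩
      exact ⟨inv_pos.2 (zero_lt_one.trans hy), inv_lt_one_of_one_lt₀ hy⟩
    · intro hx
      exact ⟨x⁻¹, (one_lt_inv₀ hx.1).2 hx.2, inv_inv x⟩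
  have hsymm : ∫ x in Ioc (0 : ℝ) 1, f x = ∫ x in Ioi (1 : ℝ), f x := by
    rw [integral_Ioc_eq_integral_Ioo, ← himg',
      integral_image_eq_integral_abs_deriv_smul measurableSet_Ioi
        (fun x hx => (hasDerivAt_inv (zero_lt_one.trans hx).ne').hasDerivWithinAt)
        inv_injective.injOn]
    refine setIntegral_congr_fun measurableSet_Ioi fun x hx => ?_
    have hx0 : (0 : ℝ) < x := zero_lt_one.trans hx
    simp only [hf, smul_eq_mul, log_inv, neg_sq, abs_neg]
    rw [abs_of_pos (by positivity)]
    have : 1 + x⁻¹ = (1 + x) / x := by field_simp; ring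
    rw [this]
    field_simp
  have hmain := integral_Ioo_one_div_sq_add_log_sq_sq
  rw [← htot, hsplit, hsymm, ← two_mul, Complex.ofReal_mul] at hmain
  have hval : ((∫ x in Ioi (1 : ℝ), f x : ℝ) : ℂ)
      = (riemannZeta 3 + riemannZeta 2) / (8 * (π : ℂ) ^ 4) := by
    have hpi : (π : ℂ) ≠ 0 := by exact_mod_cast pi_ne_zero
    push_cast at hmain
    rw [show (riemannZeta 3 + riemannZeta 2) / (8 * (π : ℂ) ^ 4)
      = (riemannZeta 3 + riemannZeta 2) / (4 * (π : ℂ) ^ 4) / 2 by ring, ← hmain]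
    ring
  refine ⟨?_, hval⟩
  rw [intervalIntegral.integral_of_le zero_le_one, hsymm, hval]
end
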